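/- Let a, b, c be real constants with c > 0, b > 0 and b² + 27ac > 0, and set s₊ = (b + √(b² + 24ac))/(4c). Then there exist δ > 0 and C > 0 such that for every Q ∈ Q₀ with dist(Q, N) < δ, if λ₁ denotes the smallest eigenvalue of Q, then |-a + bλ₁ + c|Q|²| ≤ C·dist(Q, N). -/

import Mathlib

noncomputable section

open Matrix

/-- The space of 3×3 real matrices. -/
abbrev Mat3 := Matrix (Fin 3) (Fin 3) ℝ

/-- Frobenius inner product `A : B = ∑ᵢⱼ Aᵢⱼ Bᵢⱼ`. -/
def frob (A B : Mat3) : ℝ := ∑ i, ∑ j, A i j * B i j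

/-- Frobenius norm. -/
def fnorm (A : Mat3) : ℝ := Real.sqrt (frob A A)

/-- The uniaxial matrix `s (d ⊗ d - (1/3) I)`. -/
def uniax (s : ℝ) (d : Fin 3 → ℝ) : Mat3 :=
  s • (vecMulVec d d - (1 / 3 : ℝ) • (1 : Mat3))

/-- The distance (in Frobenius norm) from `Q` to the limit manifold
`N = { s(d⊗d - (1/3)I) : |d| = 1 }`. -/
def distN (s : ℝ) (Q : Mat3) : ℝ :=
  sInf ((fun d : Fin 3 → ℝ => fnorm (Q - uniax s d)) '' {d | ∑ i, d i ^ 2 = 1})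

/-- `l` is the smallest eigenvalue of `Q`: it is an eigenvalue and is `≤` any
other eigenvalue. -/
def IsSmallestEigenvalue (Q : Mat3) (l : ℝ) : Prop :=
  (∃ u : Fin 3 → ℝ, u ≠ 0 ∧ Q.mulVec u = l • u) ∧
    ∀ μ : ℝ, (∃ u : Fin 3 → ℝ, u ≠ 0 ∧ Q.mulVec u = μ • u) → l ≤ μ

lemma frob_self_nonneg (A : Mat3) : 0 ≤ frob A A :=
  Finset.sum_nonneg fun _ _ => Finset.sum_nonneg fun _ _ => mul_self_nonneg _

lemma fnorm_nonneg (A : Mat3) : 0 ≤ fnorm A := Real.sqrt_nonneg _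

lemma fnorm_sq (A : Mat3) : fnorm A ^ 2 = frob A A := Real.sq_sqrt (frob_self_nonneg A)

/-- The Cauchy–Schwarz inequality for the Frobenius inner product. -/
lemma abs_frob_le (A B : Mat3) : |frob A B| ≤ fnorm A * fnorm B := by
  have key : frob A B ^ 2 ≤ frob A A * frob B B := by
    have := Finset.sum_mul_sq_le_sq_mul_sq (Finset.univ : Finset (Fin 3 × Fin 3))
      (fun p => A p.1 p.2) (fun p => B p.1 p.2)
    simpa only [frob, Fintype.sum_prod_type, sq] using this
  refine abs_le_of_sq_le_sq ?_ (mul_nonneg (fnorm_nonneg A) (fnorm_nonneg B))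
  rw [mul_pow, fnorm_sq, fnorm_sq]
  exact key

lemma frob_vecMulVec_self (M : Mat3) (u : Fin 3 → ℝ) :
    frob M (vecMulVec u u) = u ⬝ᵥ M *ᵥ u := by
  simp [frob, vecMulVec_apply, mulVec, dotProduct, Fin.sum_univ_three]
  ring

lemma fnorm_vecMulVec_self (u : Fin 3 → ℝ) : fnorm (vecMulVec u u) = u ⬝ᵥ u := by
  have h0 : 0 ≤ u ⬝ᵥ u := Finset.sum_nonneg fun _ _ => mul_self_nonneg _
  rw [fnorm, Real.sqrt_eq_iff_mul_self_eq (frob_self_nonneg _) h0]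
  simp [frob, vecMulVec_apply, dotProduct, Fin.sum_univ_three]
  ring

/-- The quadratic form of a matrix is bounded by its Frobenius norm. -/
lemma abs_dotProduct_mulVec_le (M : Mat3) (u : Fin 3 → ℝ) :
    |u ⬝ᵥ M *ᵥ u| ≤ fnorm M * (u ⬝ᵥ u) := by
  rw [← frob_vecMulVec_self, ← fnorm_vecMulVec_self]
  exact abs_frob_le _ _

lemma dotProduct_self_pos_of_ne_zero {u : Fin 3 → ℝ} (hu : u ≠ 0) : 0 < u ⬝ᵥ u :=
  lt_of_le_of_ne (Finset.sum_nonneg fun _ _ => mul_self_nonneg _)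
    fun h => hu (dotProduct_self_eq_zero.1 h.symm)

/-- The smallest eigenvalue is a lower bound for the quadratic form. -/
lemma IsSmallestEigenvalue.mul_le {Q : Mat3} {l : ℝ} (h : IsSmallestEigenvalue Q l)
    (hQ : Q.IsSymm) (v : Fin 3 → ℝ) : l * (v ⬝ᵥ v) ≤ v ⬝ᵥ Q *ᵥ v := by
  have hH : (Q - l • (1 : Mat3)).IsHermitian := by
    rw [IsHermitian, conjTranspose_eq_transpose_of_trivial]
    simp [hQ.eq]
  have hP : (Q - l • (1 : Mat3)).PosSemidef := by
    rw [hH.posSemidef_iff_eigenvalues_nonneg]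
    intro i
    have hv := hH.mulVec_eigenvectorBasis i
    have hne : (hH.eigenvectorBasis i).ofLp ≠ 0 := fun h0 =>
      hH.eigenvectorBasis.orthonormal.ne_zero i (WithLp.ofLp_injective 2 h0)
    have := h.2 (hH.eigenvalues i + l) ⟨_, hne, by
      rw [sub_mulVec, smul_mulVec, one_mulVec] at hv
      rw [add_smul, ← hv, sub_add_cancel]⟩
    simp only [Pi.zero_apply]
    linarith
  have := hP.dotProduct_mulVec_nonneg v
  simp only [star_trivial, sub_mulVec, smul_mulVec, one_mulVec, dotProduct_sub,
    dotProduct_smul, smul_eq_mul] at this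
  linarith

lemma dotProduct_uniax_mulVec (s : ℝ) (d u : Fin 3 → ℝ) :
    u ⬝ᵥ uniax s d *ᵥ u = s * ((d ⬝ᵥ u) ^ 2 - 1 / 3 * (u ⬝ᵥ u)) := by
  simp only [uniax, smul_mulVec, sub_mulVec, vecMulVec_mulVec, one_mulVec, dotProduct_smul,
    dotProduct_sub, op_smul_eq_smul, smul_eq_mul, dotProduct_comm u d]
  ring

lemma frob_uniax_self (s : ℝ) {d : Fin 3 → ℝ} (hd : ∑ i, d i ^ 2 = 1) :
    frob (uniax s d) (uniax s d) = 2 / 3 * s ^ 2 := by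
  rw [Fin.sum_univ_three] at hd
  simp [frob, uniax, vecMulVec_apply, Fin.sum_univ_three, one_apply]
  linear_combination s ^ 2 * (d 0 ^ 2 + d 1 ^ 2 + d 2 ^ 2 + 1 - 2 / 3) * hd

/-- The smallest eigenvalue of `Q` is close to that of a nearby uniaxial matrix. -/
lemma IsSmallestEigenvalue.abs_add_le {Q : Mat3} {l s : ℝ} (h : IsSmallestEigenvalue Q l)
    (hQ : Q.IsSymm) (hs : 0 ≤ s) (d : Fin 3 → ℝ) :
    |l + s / 3| ≤ fnorm (Q - uniax s d) := by
  have split (u : Fin 3 → ℝ) : u ⬝ᵥ Q *ᵥ u =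
      s * ((d ⬝ᵥ u) ^ 2 - 1 / 3 * (u ⬝ᵥ u)) + u ⬝ᵥ (Q - uniax s d) *ᵥ u := by
    rw [← dotProduct_uniax_mulVec, sub_mulVec, dotProduct_sub]
    ring
  rw [abs_le]
  constructor
  · obtain ⟨⟨u, hu, hQu⟩, -⟩ := h
    have hpos := dotProduct_self_pos_of_ne_zero hu
    have hsp := split u
    rw [hQu, dotProduct_smul, smul_eq_mul] at hsp
    have hM := (abs_le.1 (abs_dotProduct_mulVec_le (Q - uniax s d) u)).1
    have hsq := mul_nonneg hs (sq_nonneg (d ⬝ᵥ u))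
    refine le_of_mul_le_mul_right ?_ hpos
    linarith
  · obtain ⟨v, hv, hvd⟩ := exists_ne_zero_dotProduct_eq_zero d
    have hpos := dotProduct_self_pos_of_ne_zero hv
    have hsp := split v
    rw [dotProduct_comm d v, hvd] at hsp
    have hM := (abs_le.1 (abs_dotProduct_mulVec_le (Q - uniax s d) v)).2
    have hl := h.mul_le hQ v
    refine le_of_mul_le_mul_right ?_ hpos
    linarith

lemma abs_frob_self_sub_le (Q : Mat3) {s : ℝ} (hs : 0 ≤ s) {d : Fin 3 → ℝ}
    (hd : ∑ i, d i ^ 2 = 1) :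
    |frob Q Q - 2 / 3 * s ^ 2| ≤
      2 * s * fnorm (Q - uniax s d) + fnorm (Q - uniax s d) ^ 2 := by
  have hexp : frob Q Q - 2 / 3 * s ^ 2 =
      2 * frob (uniax s d) (Q - uniax s d) + fnorm (Q - uniax s d) ^ 2 := by
    rw [fnorm_sq, ← frob_uniax_self s hd]
    simp only [frob, Fin.sum_univ_three, Matrix.sub_apply]
    ring
  have hP : fnorm (uniax s d) ≤ s := by
    rw [fnorm, frob_uniax_self s hd]
    exact Real.sqrt_le_iff.2 ⟨hs, by nlinarith [sq_nonneg s]⟩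
  have hcs := (abs_frob_le (uniax s d) (Q - uniax s d)).trans
    (mul_le_mul_of_nonneg_right hP (fnorm_nonneg _))
  rw [hexp]
  obtain ⟨h1, h2⟩ := abs_le.1 hcs
  have h3 := sq_nonneg (fnorm (Q - uniax s d))
  rw [abs_le]
  constructor <;> linarith

/-- for `c > 0`, `b > 0`, `b² + 27ac > 0` and
`s₊ = (b + √(b²+24ac))/(4c)`, there exist `δ > 0` and `C > 0` such that
whenever `Q ∈ Q₀` satisfies `dist(Q,N) < δ` and `λ₁` is its smallest
eigenvalue, then `|-a + bλ₁ + c|Q|²| ≤ C·dist(Q,N)`. -/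
theorem stmt14 (a b c : ℝ) (hc : 0 < c) (hb : 0 < b)
    (h : 0 < b ^ 2 + 27 * a * c)
    (s : ℝ) (hs : s = (b + Real.sqrt (b ^ 2 + 24 * a * c)) / (4 * c)) :
    ∃ δ : ℝ, 0 < δ ∧ ∃ C : ℝ, 0 < C ∧
      ∀ Q : Mat3, Q.IsSymm → Q.trace = 0 → distN s Q < δ →
        ∀ l : ℝ, IsSmallestEigenvalue Q l →
          |-a + b * l + c * frob Q Q| ≤ C * distN s Q := by
  have hD : 0 ≤ b ^ 2 + 24 * a * c := by nlinarith [sq_nonneg b]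
  have hs0 : 0 < s := by rw [hs]; positivity
  have hroot : 2 * c * s ^ 2 - b * s - 3 * a = 0 := by
    have hr : Real.sqrt (b ^ 2 + 24 * a * c) = 4 * c * s - b := by
      rw [hs]; field_simp; ring
    have hsq := Real.sq_sqrt hD
    rw [hr] at hsq
    have : c * (2 * c * s ^ 2 - b * s - 3 * a) = 0 := by linarith
    exact (mul_eq_zero.1 this).resolve_left hc.ne'
  have hK : 0 < b + c * (2 * s + 1) := by positivity
  refine ⟨1, one_pos, b + c * (2 * s + 1), hK, fun Q hQ _ hdist l hl => ?_⟩
  by_contra! hcon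
  have hlt : distN s Q < min 1 (|-a + b * l + c * frob Q Q| / (b + c * (2 * s + 1))) :=
    lt_min hdist (by rwa [lt_div_iff₀ hK, mul_comm])
  obtain ⟨_, ⟨d, hd, rfl⟩, hε⟩ := exists_lt_of_csInf_lt
    (Set.Nonempty.image _ ⟨![1, 0, 0], by simp [Fin.sum_univ_three]⟩) hlt
  obtain ⟨hε1, hε2⟩ := lt_min_iff.1 hε
  rw [lt_div_iff₀ hK] at hε2
  have hε0 := fnorm_nonneg (Q - uniax s d)
  have h1 := hl.abs_add_le hQ hs0.le d
  have h2 := abs_frob_self_sub_le Q hs0.le hd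
  simp only at hε1 hε2
  set ε := fnorm (Q - uniax s d)
  have h3 : |frob Q Q - 2 / 3 * s ^ 2| ≤ (2 * s + 1) * ε := by nlinarith
  have heq : -a + b * l + c * frob Q Q =
      b * (l + s / 3) + c * (frob Q Q - 2 / 3 * s ^ 2) := by linarith
  have hb' := mul_le_mul_of_nonneg_left h1 hb.le
  have hc' := mul_le_mul_of_nonneg_left h3 hc.le
  have htri := abs_add_le (b * (l + s / 3)) (c * (frob Q Q - 2 / 3 * s ^ 2))
  rw [← heq, abs_mul, abs_mul, abs_of_pos hb, abs_of_pos hc] at htri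
  linarith
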